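/- Let S be a countable set of positive reals. Let G = iso(Q_S) be the group of bijective self-isometries of Q_S with the topology of pointwise convergence on the discrete space Q_S, and let cLO(Q_S) be the compact space of convex linear orderings of Q_S (as a subspace of 2^{Q_S × Q_S} with the product topology), with the continuous action of G given by x <^g y iff g^{-1}(x) < g^{-1}(y). Then cLO(Q_S) is the universal minimal flow of G: this action is minimal (every orbit is dense), and for every compact Hausdorff space X with a continuous minimal action of G there is a continuous G-equivariant surjection from cLO(Q_S) onto X. -/

import Mathlib

/-- The Urysohn ultrametric space `Q_S` : finitely supported functions `S → ℚ`. -/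
def QS (S : Set ℝ) := {x : S → ℚ // {s : S | x s ≠ 0}.Finite}

/-- The distance on `Q_S` : `d x y = max {s ∈ S | x s ≠ y s}` for `x ≠ y`
(and `0` for `x = y`, the supremum of the empty set being `0`). -/
noncomputable def dQ (S : Set ℝ) (x y : S → ℚ) : ℝ :=
  sSup (Subtype.val '' {s : S | x s ≠ y s})

/-- The lexicographical ordering on `Q_S` : `x <lex y` iff `x s < y s` where `s` is the
largest element of `S` at which `x` and `y` differ. -/
def lexQ (S : Set ℝ) (x y : S → ℚ) : Prop :=
  ∃ s : S, x s < y s ∧ ∀ t : S, (s : ℝ) < (t : ℝ) → x t = y t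

/-- `r` is a strict total order (irreflexive, transitive, trichotomous). -/
def IsSTO {X : Type*} (r : X → X → Prop) : Prop :=
  (∀ x, ¬ r x x) ∧ (∀ x y z, r x y → r y z → r x z) ∧ (∀ x y, r x y ∨ x = y ∨ r y x)

/-- `r` is a convex linear ordering with respect to the distance `d` : a strict total
order for which every closed metric ball is an interval (equivalently,
`r x y → r y z → d x y ≤ d x z ∧ d y z ≤ d x z`). -/
def IsConvexSTO {X : Type*} (d : X → X → ℝ) (r : X → X → Prop) : Prop :=
  IsSTO r ∧ ∀ x y z, r x y → r y z → d x y ≤ d x z ∧ d y z ≤ d x z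

/-- The group `iso(Q_S)` of bijective self-isometries of `Q_S`. -/
def IsoQ (S : Set ℝ) :=
  {g : QS S ≃ QS S // ∀ x y, dQ S (g x).1 (g y).1 = dQ S x.1 y.1}

instance (S : Set ℝ) : Group (IsoQ S) where
  mul g h := ⟨h.1.trans g.1,
    fun x y => by simp only [Equiv.trans_apply]; rw [g.2, h.2]⟩
  one := ⟨Equiv.refl _, fun x y => rfl⟩
  inv g := ⟨g.1.symm,
    fun x y => by have := g.2 (g.1.symm x) (g.1.symm y); simpa using this.symm⟩
  mul_assoc a b c := Subtype.ext (Equiv.ext fun x => rfl)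
  one_mul a := Subtype.ext (Equiv.ext fun x => rfl)
  mul_one a := Subtype.ext (Equiv.ext fun x => rfl)
  inv_mul_cancel g := Subtype.ext (Equiv.ext fun x => g.1.symm_apply_apply x)

/-- `Q_S` carries the discrete topology. -/
instance (S : Set ℝ) : TopologicalSpace (QS S) := ⊥

/-- `iso(Q_S)` carries the topology of pointwise convergence on the discrete space
`Q_S` (for the group and its inverses). -/
instance (S : Set ℝ) : TopologicalSpace (IsoQ S) :=
  TopologicalSpace.induced
    (fun g : IsoQ S => ((g.1 : QS S → QS S), (g.1.symm : QS S → QS S)))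
    inferInstance

/-- The space `cLO(Q_S)` of convex linear orderings of `Q_S` (as Boolean relations),
a subspace of `2^{Q_S × Q_S}` with the product topology. -/
def cLOQ (S : Set ℝ) :=
  {r : QS S → QS S → Bool //
    IsConvexSTO (fun x y : QS S => dQ S x.1 y.1) (fun x y => r x y = true)}

instance (S : Set ℝ) : TopologicalSpace (cLOQ S) :=
  inferInstanceAs (TopologicalSpace
    {r : QS S → QS S → Bool //
      IsConvexSTO (fun x y : QS S => dQ S x.1 y.1) (fun x y => r x y = true)})

/-- The action of `iso(Q_S)` on `cLO(Q_S)` : `x <^g y` iff `g⁻¹ x < g⁻¹ y`. -/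
def actQ (S : Set ℝ) (g : IsoQ S) (r : cLOQ S) : cLOQ S :=
  ⟨fun x y => r.1 (g.1.symm x) (g.1.symm y), by
    obtain ⟨⟨hirr, htr, htri⟩, hconv⟩ := r.2
    have e : ∀ a b : QS S, dQ S (g.1.symm a).1 (g.1.symm b).1 = dQ S a.1 b.1 := by
      intro a b
      have := g.2 (g.1.symm a) (g.1.symm b)
      simpa using this.symm
    refine ⟨⟨fun x => hirr _, fun x y z hxy hyz => htr _ _ _ hxy hyz, fun x y => ?_⟩,
      fun x y z hxy hyz => ?_⟩
    · rcases htri (g.1.symm x) (g.1.symm y) with h | h | h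
      · exact Or.inl h
      · exact Or.inr (Or.inl (g.1.symm.injective h))
      · exact Or.inr (Or.inr h)
    · have h := hconv _ _ _ hxy hyz
      simpa only [e] using h⟩

section OrderAutRat

open Filter

theorem Finset.exists_homogeneous {α κ : Type*} [Infinite α] [DecidableEq α] [Finite κ]
    (c : Finset α → κ) (n m : ℕ) :
    ∃ B : Finset α, B.card = m ∧ ∃ k, ∀ T ⊆ B, T.card = n → c T = k := by
  have hlim : ∀ f : α → κ, ∃ k, ∀ᶠ t in (hyperfilter α : Filter α), f t = k := by
    intro f
    by_contra! h
    have h' : ∀ᶠ t in (hyperfilter α : Filter α), ∀ k, f t ≠ k :=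
      eventually_all.2 fun k => h k
    obtain ⟨t, ht⟩ := h'.exists
    exact ht _ rfl
  choose L hL using hlim
  let D : ℕ → Finset α → κ := fun j => Nat.rec c (fun _ D T => L fun t => D (insert t T)) j
  have hD : ∀ j T, ∀ᶠ t in (hyperfilter α : Filter α), D j (insert t T) = D (j + 1) T :=
    fun j T => hL _
  suffices h : ∃ B : Finset α, B.card = m ∧
      ∀ T ⊆ B, T.card ≤ n → D (n - T.card) T = D n ∅ by
    obtain ⟨B, hB, h⟩ := h
    refine ⟨B, hB, D n ∅, fun T hT hn => ?_⟩
    have := h T hT hn.le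
    rwa [hn, Nat.sub_self] at this
  induction m with
  | zero =>
    refine ⟨∅, rfl, fun T hT _ => ?_⟩
    rw [Finset.subset_empty.1 hT, Finset.card_empty, Nat.sub_zero]
  | succ m ih =>
    obtain ⟨B, hB, h⟩ := ih
    have h1 : ∀ᶠ t in (hyperfilter α : Filter α), t ∉ B :=
      hyperfilter_le_cofinite (B.finite_toSet.compl_mem_cofinite)
    have h2 : ∀ᶠ t in (hyperfilter α : Filter α), ∀ T ∈ B.powerset,
        D (n - T.card - 1) (insert t T) = D (n - T.card - 1 + 1) T :=
      (Finset.eventually_all _).2 fun T _ => hD _ T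
    obtain ⟨t, ht, hT⟩ := (h1.and h2).exists
    refine ⟨insert t B, by rw [Finset.card_insert_of_notMem ht, hB], fun T hTB hn => ?_⟩
    by_cases htT : t ∈ T
    · have hsub : T.erase t ⊆ B := Finset.subset_insert_iff.1 hTB
      have hcard := Finset.card_erase_add_one htT
      have h3 := hT _ (Finset.mem_powerset.2 hsub)
      rw [Finset.insert_erase htT] at h3
      rw [← h _ hsub (by omega)]
      rw [show n - T.card = n - (T.erase t).card - 1 by omega, h3,
        Nat.sub_add_cancel (by omega)]
    · exact h T ((Finset.subset_insert_iff_of_notMem htT).1 hTB) hn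

/-- The piecewise linear map fixing everything outside `(l, u)` and mapping `p` to `q`. -/
def kink (l p q u x : ℚ) : ℚ :=
  if x ≤ l then x else if x ≤ p then l + (x - l) * ((q - l) / (p - l))
  else if x ≤ u then u - (u - x) * ((u - q) / (u - p)) else x

theorem kink_of_le_left {l p q u x : ℚ} (h : x ≤ l) : kink l p q u x = x := if_pos h

theorem kink_of_right_le {l p q u x : ℚ} (hlp : l < p) (hpu : p < u) (h : u ≤ x) :
    kink l p q u x = x := by
  unfold kink
  rw [if_neg (by linarith), if_neg (by linarith)]
  split_ifs with h1
  · rw [le_antisymm h1 h]; ring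
  · rfl

theorem kink_left_part {l p q u x : ℚ} (h1 : l < x) (h2 : x ≤ p) :
    kink l p q u x = l + (x - l) * ((q - l) / (p - l)) := by
  unfold kink
  rw [if_neg (by linarith), if_pos h2]

theorem kink_right_part {l p q u x : ℚ} (hlp : l < p) (h1 : p < x) (h2 : x ≤ u) :
    kink l p q u x = u - (u - x) * ((u - q) / (u - p)) := by
  unfold kink
  rw [if_neg (by linarith), if_neg (by linarith), if_pos h2]

theorem kink_apply {l p q u : ℚ} (hlp : l < p) : kink l p q u p = q := by
  rw [kink_left_part hlp le_rfl, mul_div_cancel₀ _ (by linarith)]; ring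

theorem kink_kink {l p q u : ℚ} (hlp : l < p) (hlq : l < q) (hpu : p < u) (hqu : q < u) (x : ℚ) :
    kink l q p u (kink l p q u x) = x := by
  have e1 : 0 < q - l := by linarith
  have e2 : 0 < p - l := by linarith
  have e3 : 0 < u - q := by linarith
  have e4 : 0 < u - p := by linarith
  rcases le_or_gt x l with h | h
  · rw [kink_of_le_left h, kink_of_le_left h]
  rcases le_or_gt x p with h' | h'
  · rw [kink_left_part h h', kink_left_part]
    · field_simp; ring
    · have : 0 < (x - l) * ((q - l) / (p - l)) := by
        have : 0 < x - l := by linarith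
        positivity
      linarith
    · have : (x - l) * ((q - l) / (p - l)) ≤ (p - l) * ((q - l) / (p - l)) := by
        gcongr
      rw [mul_div_cancel₀ _ (by linarith)] at this
      linarith
  rcases le_or_gt u x with h'' | h''
  · rw [kink_of_right_le hlp hpu h'', kink_of_right_le hlq hqu h'']
  · rw [kink_right_part hlp h' h''.le, kink_right_part hlq]
    · field_simp; ring
    · have : (u - x) * ((u - q) / (u - p)) < (u - p) * ((u - q) / (u - p)) := by
        gcongr
      rw [mul_div_cancel₀ _ (by linarith)] at this
      linarith
    · have : 0 < (u - x) * ((u - q) / (u - p)) := by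
        have : 0 < u - x := by linarith
        positivity
      linarith

theorem kink_mono {l p q u : ℚ} (hlp : l < p) (hlq : l < q) (hpu : p < u) (hqu : q < u) :
    Monotone (kink l p q u) := by
  have e1 : 0 < q - l := by linarith
  have e2 : 0 < p - l := by linarith
  have e3 : 0 < u - q := by linarith
  have e4 : 0 < u - p := by linarith
  have A : MonotoneOn (kink l p q u) (Set.Iic l) := fun x hx y hy h => by
    rw [kink_of_le_left hx, kink_of_le_left hy]; exact h
  have hl : ∀ x, l ≤ x → x ≤ p → kink l p q u x = l + (x - l) * ((q - l) / (p - l)) := by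
    intro x h1 h2
    rcases h1.eq_or_lt with rfl | h1
    · rw [kink_of_le_left le_rfl]; ring
    · exact kink_left_part h1 h2
  have hr : ∀ x, p ≤ x → x ≤ u → kink l p q u x = u - (u - x) * ((u - q) / (u - p)) := by
    intro x h1 h2
    rcases h1.eq_or_lt with rfl | h1
    · rw [kink_apply hlp, mul_div_cancel₀ _ (by linarith)]; ring
    · exact kink_right_part hlp h1 h2
  have B : MonotoneOn (kink l p q u) (Set.Icc l p) := fun x hx y hy h => by
    rw [hl x hx.1 hx.2, hl y hy.1 hy.2]; gcongr
  have C : MonotoneOn (kink l p q u) (Set.Icc p u) := fun x hx y hy h => by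
    rw [hr x hx.1 hx.2, hr y hy.1 hy.2]; gcongr
  have D : MonotoneOn (kink l p q u) (Set.Ici u) := fun x hx y hy h => by
    rw [kink_of_right_le hlp hpu hx, kink_of_right_le hlp hpu hy]; exact h
  have AB := A.union_right B isGreatest_Iic (isLeast_Icc hlp.le)
  rw [Set.Iic_union_Icc_eq_Iic hlp.le] at AB
  have CD := C.union_right D (isGreatest_Icc hpu.le) isLeast_Ici
  rw [Set.Icc_union_Ici_eq_Ici hpu.le] at CD
  exact AB.Iic_union_Ici CD

theorem exists_orderIso_of_gap (F : Finset ℚ) (p q : ℚ)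
    (h : ∀ a ∈ F, (a < p ↔ a < q) ∧ (p < a ↔ q < a)) :
    ∃ σ : ℚ ≃o ℚ, (∀ a ∈ F, σ a = a) ∧ σ p = q := by
  have hl : ∃ l, (∀ a ∈ F, a < min p q → a < l) ∧ l < min p q := by
    have h1 : ∀ᶠ l in nhdsWithin (min p q) (Set.Iio (min p q)),
        ∀ a ∈ F, a < min p q → a < l :=
      (Finset.eventually_all _).2 fun a _ => by
        by_cases ha : a < min p q
        · filter_upwards [Ioo_mem_nhdsLT ha] with l hl _ using hl.1
        · exact Eventually.of_forall fun l h => absurd h ha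
    exact (h1.and self_mem_nhdsWithin).exists
  have hu : ∃ u, (∀ a ∈ F, max p q < a → u < a) ∧ max p q < u := by
    have h1 : ∀ᶠ u in nhdsWithin (max p q) (Set.Ioi (max p q)),
        ∀ a ∈ F, max p q < a → u < a :=
      (Finset.eventually_all _).2 fun a _ => by
        by_cases ha : max p q < a
        · filter_upwards [Ioo_mem_nhdsGT ha] with l hl _ using hl.2
        · exact Eventually.of_forall fun l h => absurd h ha
    exact (h1.and self_mem_nhdsWithin).exists
  obtain ⟨l, hl, hlm⟩ := hl
  obtain ⟨u, hu, hmu⟩ := hu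
  obtain ⟨hlp, hlq⟩ := lt_min_iff.1 hlm
  obtain ⟨hpu, hqu⟩ := max_lt_iff.1 hmu
  let e : ℚ ≃ ℚ := ⟨kink l p q u, kink l q p u, kink_kink hlp hlq hpu hqu,
    kink_kink hlq hlp hqu hpu⟩
  refine ⟨e.toOrderIso (kink_mono hlp hlq hpu hqu) (kink_mono hlq hlp hqu hpu),
    fun a ha => ?_, kink_apply hlp⟩
  change kink l p q u a = a
  rcases lt_trichotomy a p with h1 | h1 | h1
  · exact kink_of_le_left (hl a ha (lt_min h1 ((h a ha).1.1 h1))).le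
  · have : a = q := le_antisymm (not_lt.1 fun h2 => by
      have := (h a ha).2.2 h2; exact absurd h1 this.ne') (not_lt.1 fun h2 => by
      have := (h a ha).1.2 h2; exact absurd h1 this.ne)
    subst h1
    rw [kink_apply hlp, ← this]
  · exact kink_of_right_le hlp hpu (hu a ha (max_lt h1 ((h a ha).2.1 h1))).le

theorem exists_orderIso_extending {ι : Type*} (s : Finset ι) (u v : ι → ℚ)
    (h : ∀ i ∈ s, ∀ j ∈ s, u i < u j ↔ v i < v j) :
    ∃ τ : ℚ ≃o ℚ, ∀ i ∈ s, τ (u i) = v i := by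
  classical
  induction s using Finset.induction_on with
  | empty => exact ⟨OrderIso.refl _, by simp⟩
  | insert i s _ ih =>
    obtain ⟨τ, hτ⟩ := ih fun i hi j hj =>
      h i (Finset.mem_insert_of_mem hi) j (Finset.mem_insert_of_mem hj)
    obtain ⟨σ, hσ, hp⟩ := exists_orderIso_of_gap (s.image v) (τ (u i)) (v i) (by
      intro a ha
      obtain ⟨j, hj, rfl⟩ := Finset.mem_image.1 ha
      rw [← hτ j hj, τ.lt_iff_lt, τ.lt_iff_lt, hτ j hj]
      exact ⟨h _ (Finset.mem_insert_of_mem hj) _ (Finset.mem_insert_self _ _),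
        h _ (Finset.mem_insert_self _ _) _ (Finset.mem_insert_of_mem hj)⟩)
    refine ⟨τ.trans σ, fun j hj => ?_⟩
    rcases Finset.mem_insert.1 hj with rfl | hj
    · exact hp
    · rw [OrderIso.trans_apply, hτ j hj, hσ _ (Finset.mem_image_of_mem _ hj)]

theorem exists_orderIso_image_eq (B C : Finset ℚ) (h : B.card = C.card) :
    ∃ τ : ℚ ≃o ℚ, B.image τ = C := by
  obtain ⟨τ, hτ⟩ := exists_orderIso_extending Finset.univ (B.orderEmbOfFin rfl)
    (C.orderEmbOfFin h.symm) (by simp)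
  refine ⟨τ, Finset.eq_of_subset_of_card_le (fun x hx => ?_) ?_⟩
  · obtain ⟨y, hy, rfl⟩ := Finset.mem_image.1 hx
    have : y ∈ Set.range (B.orderEmbOfFin rfl) := by rwa [Finset.range_orderEmbOfFin]
    obtain ⟨i, rfl⟩ := this
    rw [hτ i (Finset.mem_univ _)]
    exact Finset.orderEmbOfFin_mem _ _ _
  · rw [Finset.card_image_of_injective _ τ.injective, h]

theorem OrderIso.eq_self_of_image_eq (F : Finset ℚ) (σ : ℚ ≃o ℚ) (h : F.image σ = F) :
    ∀ q ∈ F, σ q = q := by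
  have key := Finset.orderEmbOfFin_unique (s := F) rfl (f := fun i => σ (F.orderEmbOfFin rfl i))
    (fun i => by
      have := Finset.mem_image_of_mem σ (F.orderEmbOfFin_mem rfl i)
      rwa [h] at this)
    (σ.strictMono.comp (F.orderEmbOfFin rfl).strictMono)
  intro q hq
  have : q ∈ Set.range (F.orderEmbOfFin rfl) := by rwa [Finset.range_orderEmbOfFin]
  obtain ⟨i, rfl⟩ := this
  exact congrFun key i

open Uniformity in
theorem exists_almost_fixed {G X : Type*} [Group G] [UniformSpace X] [CompactSpace X]
    [MulAction G X] (ρ : (ℚ ≃o ℚ) →* G)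
    (hU : ∀ U ∈ 𝓤 X, ∃ F : Finset ℚ, ∀ σ : ℚ ≃o ℚ, (∀ q ∈ F, σ q = q) →
      ∀ x : X, (ρ σ • x, x) ∈ U)
    (y₀ : X) (U : Set (X × X)) (hUX : U ∈ 𝓤 X) (E : Finset (ℚ ≃o ℚ)) :
    ∃ τ : ℚ ≃o ℚ, ∀ σ ∈ E, (ρ σ • ρ τ • y₀, ρ τ • y₀) ∈ U := by
  classical
  obtain ⟨W, hW, hWsymm, hWU⟩ := comp_symm_mem_uniformity_sets hUX
  obtain ⟨V, hV, -, hVW⟩ := comp_symm_mem_uniformity_sets hW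
  obtain ⟨F, hF⟩ := hU V hV
  obtain ⟨t, ht, hcov⟩ := (isCompact_univ (X := X)).totallyBounded V hV
  have hcol : ∀ x : X, ∃ z : t, (x, z.1) ∈ V := fun x => by
    obtain ⟨z, hz, hxz⟩ := Set.mem_iUnion₂.1 (hcov (Set.mem_univ x))
    exact ⟨⟨z, hz⟩, hxz⟩
  choose col hcol using hcol
  have hex : ∀ T : Finset ℚ, ∃ g : ℚ ≃o ℚ, T.card = F.card → F.image g = T := fun T => by
    by_cases h : T.card = F.card
    · obtain ⟨g, hg⟩ := exists_orderIso_image_eq F T h.symm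
      exact ⟨g, fun _ => hg⟩
    · exact ⟨1, fun h' => absurd h' h⟩
  choose g hg using hex
  have := ht.to_subtype
  let B : Finset ℚ := F ∪ E.biUnion fun σ => F.image (σ⁻¹ : ℚ ≃o ℚ)
  obtain ⟨C, hC, k, hk⟩ :=
    Finset.exists_homogeneous (fun T : Finset ℚ => col (ρ (g T)⁻¹ • y₀)) F.card B.card
  obtain ⟨τ, hτ⟩ := exists_orderIso_image_eq B C hC.symm
  have near : ∀ γ : ℚ ≃o ℚ, F.image γ ⊆ C → (ρ γ⁻¹ • y₀, k.1) ∈ W := by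
    intro γ hγ
    have hcard : (F.image γ).card = F.card := Finset.card_image_of_injective _ γ.injective
    have h1 := hcol (ρ (g (F.image γ))⁻¹ • y₀)
    rw [hk _ hγ hcard] at h1
    have h2 := hF (γ⁻¹ * g (F.image γ)) (OrderIso.eq_self_of_image_eq F _ (by
      have : ((γ⁻¹ * g (F.image γ) : ℚ ≃o ℚ) : ℚ → ℚ) = (γ⁻¹ : ℚ ≃o ℚ) ∘ g (F.image γ) := rfl
      rw [this, ← Finset.image_image, hg _ hcard, Finset.image_image]
      have : ((γ⁻¹ : ℚ ≃o ℚ) : ℚ → ℚ) ∘ γ = id := funext fun x => γ.symm_apply_apply x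
      rw [this, Finset.image_id])) (ρ (g (F.image γ))⁻¹ • y₀)
    rw [smul_smul, ← map_mul, mul_assoc, mul_inv_cancel, mul_one] at h2
    exact hVW ⟨_, h2, h1⟩
  refine ⟨τ⁻¹, fun σ hσ => ?_⟩
  have h1 := near (τ * σ⁻¹) (by
    have : ((τ * σ⁻¹ : ℚ ≃o ℚ) : ℚ → ℚ) = τ ∘ (σ⁻¹ : ℚ ≃o ℚ) := rfl
    rw [this, ← Finset.image_image, ← hτ]
    exact Finset.image_subset_image ((Finset.subset_biUnion_of_mem
      (fun σ : ℚ ≃o ℚ => F.image (σ⁻¹ : ℚ ≃o ℚ)) hσ).trans Finset.subset_union_right))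
  have h2 := SetRel.symm W <| near τ (by
    rw [← hτ]
    exact Finset.image_subset_image Finset.subset_union_left)
  rw [mul_inv_rev, inv_inv, map_mul, mul_smul] at h1
  exact hWU ⟨_, h1, h2⟩

open Uniformity in
theorem exists_fixed_of_orderIso_action {G X : Type*} [Group G] [UniformSpace X] [CompactSpace X]
    [T2Space X] [MulAction G X] [ContinuousConstSMul G X] (ρ : (ℚ ≃o ℚ) →* G)
    (hU : ∀ U ∈ 𝓤 X, ∃ F : Finset ℚ, ∀ σ : ℚ ≃o ℚ, (∀ q ∈ F, σ q = q) →
      ∀ x : X, (ρ σ • x, x) ∈ U)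
    {Y : Set X} (hY : IsClosed Y) (hne : Y.Nonempty) (hinv : ∀ σ, ∀ y ∈ Y, ρ σ • y ∈ Y) :
    ∃ y ∈ Y, ∀ σ, ρ σ • y = y := by
  classical
  obtain ⟨y₀, hy₀⟩ := hne
  have key := hY.isCompact.inter_iInter_nonempty
    (fun i : {U : Set (X × X) // U ∈ 𝓤 X ∧ IsClosed U} × (ℚ ≃o ℚ) =>
      {y : X | (ρ i.2 • y, y) ∈ i.1.1})
    (fun i => i.1.2.2.preimage (by fun_prop)) (fun u => by
      obtain ⟨τ, hτ⟩ := exists_almost_fixed ρ hU y₀ (⋂ i ∈ u, i.1.1)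
        ((biInter_finset_mem u).2 fun i _ => i.1.2.1) (u.image Prod.snd)
      refine ⟨ρ τ • y₀, hinv _ _ hy₀, Set.mem_iInter₂.2 fun i hi => ?_⟩
      exact Set.mem_iInter₂.1 (hτ i.2 (Finset.mem_image_of_mem _ hi)) i hi)
  obtain ⟨y, hy, h⟩ := key
  refine ⟨y, hy, fun σ => ?_⟩
  refine eq_of_uniformity_basis uniformity_hasBasis_closed fun {U} hU => ?_
  exact Set.mem_iInter.1 h (⟨U, hU⟩, σ)

end OrderAutRat

section UrysohnUltrametric

variable {S : Set ℝ}

/-- `x` and `y` have the same coordinates above level `s`. -/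
def AgreeAbove (s : S) (x y : QS S) : Prop := ∀ t : S, s < t → x.1 t = y.1 t

/-- `s` is the largest coordinate at which `x` and `y` differ. -/
def TopDiff (s : S) (x y : QS S) : Prop := x.1 s ≠ y.1 s ∧ AgreeAbove s x y

theorem AgreeAbove.refl (s : S) (x : QS S) : AgreeAbove s x x := fun _ _ => rfl

theorem AgreeAbove.symm {s : S} {x y : QS S} (h : AgreeAbove s x y) : AgreeAbove s y x :=
  fun t ht => (h t ht).symm

theorem AgreeAbove.trans {s : S} {x y z : QS S} (h : AgreeAbove s x y) (h' : AgreeAbove s y z) :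
    AgreeAbove s x z := fun t ht => (h t ht).trans (h' t ht)

theorem TopDiff.symm {s : S} {x y : QS S} (h : TopDiff s x y) : TopDiff s y x :=
  ⟨h.1.symm, h.2.symm⟩

theorem TopDiff.ne {s : S} {x y : QS S} (h : TopDiff s x y) : x ≠ y :=
  fun e => h.1 (by rw [e])

theorem TopDiff.trans_lt {s t : S} {x y z : QS S} (h : TopDiff s x y) (h' : TopDiff t x z)
    (hst : s < t) : TopDiff t y z :=
  ⟨by rw [← h.2 t hst]; exact h'.1, fun u hu => by rw [← h.2 u (hst.trans hu), h'.2 u hu]⟩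

theorem QS.ext {x y : QS S} (h : ∀ t, x.1 t = y.1 t) : x = y := Subtype.ext (funext h)

theorem finite_ne (x y : QS S) : {t : S | x.1 t ≠ y.1 t}.Finite := by
  refine (x.2.union y.2).subset fun t (ht : x.1 t ≠ y.1 t) => ?_
  by_cases h : x.1 t = 0
  · exact Or.inr fun h' => ht (h.trans h'.symm)
  · exact Or.inl h

theorem exists_topDiff {x y : QS S} (h : x ≠ y) : ∃ s, TopDiff s x y := by
  have hne : {t : S | x.1 t ≠ y.1 t}.Nonempty := by
    by_contra hemp
    refine h (QS.ext fun t => ?_)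
    by_contra ht
    exact hemp ⟨t, ht⟩
  obtain ⟨s, hs, hmax⟩ := Set.exists_max_image _ id (finite_ne x y) hne
  refine ⟨s, hs, fun t ht => ?_⟩
  by_contra hxy
  exact absurd (hmax t hxy) (not_le.2 ht)

theorem TopDiff.dQ_eq {s : S} {x y : QS S} (h : TopDiff s x y) : dQ S x.1 y.1 = s := by
  refine IsGreatest.csSup_eq ⟨⟨s, h.1, rfl⟩, ?_⟩
  rintro _ ⟨t, ht, rfl⟩
  by_contra hst
  exact ht (h.2 t (not_le.1 hst))

theorem dQ_self (x : QS S) : dQ S x.1 x.1 = 0 := by simp [dQ]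

theorem TopDiff.unique {s t : S} {x y : QS S} (h : TopDiff s x y) (h' : TopDiff t x y) : s = t :=
  Subtype.ext (h.dQ_eq.symm.trans h'.dQ_eq)

theorem IsoQ.ext {g h : IsoQ S} (H : ∀ x, g.1 x = h.1 x) : g = h :=
  Subtype.ext (Equiv.ext H)

theorem IsoQ.mul_apply (g h : IsoQ S) (x : QS S) : (g * h).1 x = g.1 (h.1 x) := rfl

theorem IsoQ.inv_apply_apply (g : IsoQ S) (x : QS S) : (g⁻¹).1 (g.1 x) = x :=
  g.1.symm_apply_apply x

theorem IsoQ.apply_inv_apply (g : IsoQ S) (x : QS S) : g.1 ((g⁻¹).1 x) = x :=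
  g.1.apply_symm_apply x

/-- A permutation preserving the top differing coordinate is an isometry. -/
def IsoQ.ofTopDiff (e : QS S ≃ QS S) (h : ∀ s x y, TopDiff s x y → TopDiff s (e x) (e y)) :
    IsoQ S :=
  ⟨e, fun x y => by
    by_cases hxy : x = y
    · rw [hxy, dQ_self, dQ_self]
    · obtain ⟨s, hs⟩ := exists_topDiff hxy
      rw [hs.dQ_eq, (h s x y hs).dQ_eq]⟩

/-- `x` with its coordinate `s` replaced by `q`. -/
noncomputable def QS.update (x : QS S) (s : S) (q : ℚ) : QS S := by
  classical
  exact ⟨Function.update x.1 s q, (x.2.insert s).subset fun t ht => by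
    by_cases h : t = s
    · exact Or.inl h
    · refine Or.inr ?_
      rwa [Set.mem_ofPred_eq, Function.update_of_ne h] at ht⟩

theorem QS.update_self (x : QS S) (s : S) (q : ℚ) : (x.update s q).1 s = q := by
  simp [QS.update]

theorem QS.update_of_ne (x : QS S) {s t : S} (q : ℚ) (h : t ≠ s) :
    (x.update s q).1 t = x.1 t := by
  simp [QS.update, h]

theorem QS.agreeAbove_update (x : QS S) (s : S) (q : ℚ) : AgreeAbove s (x.update s q) x :=
  fun _ ht => x.update_of_ne q ht.ne'

theorem QS.update_eq (x : QS S) (s : S) : x.update s (x.1 s) = x :=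
  QS.ext fun t => by
    by_cases h : t = s
    · rw [h, x.update_self]
    · rw [x.update_of_ne _ h]

theorem QS.update_update (x : QS S) (s : S) (q q' : ℚ) :
    (x.update s q).update s q' = x.update s q' :=
  QS.ext fun t => by
    by_cases h : t = s
    · rw [h, QS.update_self, QS.update_self]
    · rw [QS.update_of_ne _ _ h, QS.update_of_ne _ _ h, QS.update_of_ne _ _ h]

open Classical in
/-- Apply `σ` to the coordinate `s` of the points agreeing with `b` above `s`. -/
noncomputable def nodeFun (s : S) (b : QS S) (σ : ℚ → ℚ) (x : QS S) : QS S :=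
  if AgreeAbove s x b then x.update s (σ (x.1 s)) else x

theorem nodeFun_pos {s : S} {b x : QS S} (σ : ℚ → ℚ) (h : AgreeAbove s x b) :
    nodeFun s b σ x = x.update s (σ (x.1 s)) := if_pos h

theorem nodeFun_neg {s : S} {b x : QS S} (σ : ℚ → ℚ) (h : ¬ AgreeAbove s x b) :
    nodeFun s b σ x = x := if_neg h

theorem nodeFun_of_ne (s : S) (b x : QS S) (σ : ℚ → ℚ) {t : S} (h : t ≠ s) :
    (nodeFun s b σ x).1 t = x.1 t := by
  by_cases hx : AgreeAbove s x b
  · rw [nodeFun_pos σ hx, QS.update_of_ne _ _ h]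
  · rw [nodeFun_neg σ hx]

theorem agreeAbove_nodeFun (s : S) (b x : QS S) (σ : ℚ → ℚ) : AgreeAbove s (nodeFun s b σ x) x :=
  fun _ ht => nodeFun_of_ne s b x σ ht.ne'

theorem nodeFun_comp (s : S) (b x : QS S) (σ τ : ℚ → ℚ) :
    nodeFun s b σ (nodeFun s b τ x) = nodeFun s b (σ ∘ τ) x := by
  by_cases hx : AgreeAbove s x b
  · rw [nodeFun_pos σ ((agreeAbove_nodeFun s b x τ).trans hx), nodeFun_pos τ hx, nodeFun_pos _ hx,
      QS.update_update, QS.update_self]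
    rfl
  · rw [nodeFun_neg τ hx, nodeFun_neg σ hx, nodeFun_neg _ hx]

theorem nodeFun_id (s : S) (b x : QS S) : nodeFun s b id x = x := by
  by_cases hx : AgreeAbove s x b
  · rw [nodeFun_pos _ hx]; exact x.update_eq s
  · exact nodeFun_neg _ hx

theorem nodeFun_apply_self {s : S} {b x y : QS S} (hxy : AgreeAbove s x y) (σ : ℚ → ℚ) :
    (∃ f ∈ ({σ, id} : Set (ℚ → ℚ)), (nodeFun s b σ x).1 s = f (x.1 s) ∧
      (nodeFun s b σ y).1 s = f (y.1 s)) := by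
  by_cases hx : AgreeAbove s x b
  · refine ⟨σ, Or.inl rfl, ?_, ?_⟩
    · rw [nodeFun_pos σ hx, QS.update_self]
    · rw [nodeFun_pos σ (hxy.symm.trans hx), QS.update_self]
  · refine ⟨id, Or.inr rfl, ?_, ?_⟩
    · rw [nodeFun_neg σ hx]; rfl
    · rw [nodeFun_neg σ fun h => hx (hxy.trans h)]; rfl

theorem topDiff_nodeFun (s : S) (b : QS S) {σ : ℚ → ℚ} (hσ : Function.Injective σ) (t : S)
    (x y : QS S) (h : TopDiff t x y) : TopDiff t (nodeFun s b σ x) (nodeFun s b σ y) := by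
  have key : ∀ u, AgreeAbove u x y →
      ((nodeFun s b σ x).1 u = (nodeFun s b σ y).1 u ↔ x.1 u = y.1 u) := by
    intro u hu
    by_cases hus : u = s
    · subst hus
      obtain ⟨f, hf, hfx, hfy⟩ := nodeFun_apply_self (b := b) hu σ
      have hinj : Function.Injective f := by
        rcases hf with rfl | rfl
        exacts [hσ, Function.injective_id]
      rw [hfx, hfy, hinj.eq_iff]
    · rw [nodeFun_of_ne _ _ _ _ hus, nodeFun_of_ne _ _ _ _ hus]
  exact ⟨fun e => h.1 ((key t h.2).1 e),
    fun u hu => (key u fun v hv => h.2 v (hu.trans hv)).2 (h.2 u hu)⟩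

/-- The copy of the symmetric group of `ℚ` acting at the node of level `s` below `b`. -/
noncomputable def nodePerm (s : S) (b : QS S) : Equiv.Perm ℚ →* IsoQ S where
  toFun σ := IsoQ.ofTopDiff
    ⟨nodeFun s b σ, nodeFun s b σ.symm,
      fun x => by rw [nodeFun_comp, σ.symm_comp_self, nodeFun_id],
      fun x => by rw [nodeFun_comp, σ.self_comp_symm, nodeFun_id]⟩
    (topDiff_nodeFun s b σ.injective)
  map_one' := IsoQ.ext fun x => nodeFun_id s b x
  map_mul' σ τ := IsoQ.ext fun x => (nodeFun_comp s b x σ τ).symm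

/-- The copy of the automorphism group of `(ℚ, <)` acting at the node of level `s` below `b`. -/
noncomputable def nodeAut (s : S) (b : QS S) : (ℚ ≃o ℚ) →* IsoQ S where
  toFun σ := nodePerm s b σ.toEquiv
  map_one' := (nodePerm s b).map_one
  map_mul' σ τ := (nodePerm s b).map_mul σ.toEquiv τ.toEquiv

theorem nodePerm_apply (s : S) (b x : QS S) (σ : Equiv.Perm ℚ) :
    (nodePerm s b σ).1 x = nodeFun s b σ x := rfl

theorem nodeAut_apply (s : S) (b x : QS S) (σ : ℚ ≃o ℚ) :
    (nodeAut s b σ).1 x = nodeFun s b σ x := rfl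

theorem nodeFun_fixes {s : S} {b x : QS S} {σ : ℚ → ℚ} (h : AgreeAbove s x b → σ (x.1 s) = x.1 s) :
    nodeFun s b σ x = x := by
  by_cases hx : AgreeAbove s x b
  · rw [nodeFun_pos σ hx, h hx, x.update_eq]
  · exact nodeFun_neg σ hx

theorem nodeAut_eq_of_agreeAbove {s : S} {b b' : QS S} (h : AgreeAbove s b b') (σ : ℚ ≃o ℚ) :
    nodeAut s b σ = nodeAut s b' σ :=
  IsoQ.ext fun x => by
    rw [nodeAut_apply, nodeAut_apply]
    by_cases hx : AgreeAbove s x b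
    · rw [nodeFun_pos _ hx, nodeFun_pos _ (hx.trans h)]
    · rw [nodeFun_neg _ hx, nodeFun_neg _ fun h' => hx (h'.trans h.symm)]

theorem nodeAut_mul_of_not_agreeAbove {s : S} {b b' : QS S} (h : ¬ AgreeAbove s b b')
    (σ τ : ℚ ≃o ℚ) : nodeAut s b σ * nodeAut s b' τ = nodeAut s b' τ * nodeAut s b σ :=
  IsoQ.ext fun x => by
    simp only [IsoQ.mul_apply, nodeAut_apply]
    by_cases hx : AgreeAbove s x b
    · have h1 : ∀ y, AgreeAbove s y x → ¬ AgreeAbove s y b' :=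
        fun y hy hy' => h (hx.symm.trans (hy.symm.trans hy'))
      rw [nodeFun_neg τ (h1 x (AgreeAbove.refl s x)),
        nodeFun_neg τ (h1 _ (agreeAbove_nodeFun s b x σ))]
    · rw [nodeFun_neg σ hx, nodeFun_neg σ fun h' => hx ((agreeAbove_nodeFun s b' x τ).symm.trans h')]

theorem AgreeAbove.nodeAut {t : S} (b : QS S) (τ : ℚ ≃o ℚ) {s : S} {x y : QS S}
    (h : AgreeAbove s x y) : AgreeAbove s ((nodeAut t b τ).1 x) ((nodeAut t b τ).1 y) := by
  by_cases hxy : x = y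
  · rw [hxy]; exact AgreeAbove.refl s _
  · obtain ⟨u, hu⟩ := exists_topDiff hxy
    have hus : u ≤ s := not_lt.1 fun hsu => hu.1 (h u hsu)
    exact fun v hv => (topDiff_nodeFun t b τ.injective u x y hu).2 v (hus.trans_lt hv)

theorem nodeAut_mul_nodeAut_of_lt {s t : S} (hst : s < t) (b c : QS S) (σ τ : ℚ ≃o ℚ) :
    nodeAut s b σ * nodeAut t c τ =
      nodeAut t c τ * nodeAut s ((nodeAut t c τ)⁻¹.1 b) σ :=
  IsoQ.ext fun x => by
    simp only [IsoQ.mul_apply]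
    set b' := (nodeAut t c τ)⁻¹.1 b with hb'
    have hb : b = (nodeAut t c τ).1 b' := (IsoQ.apply_inv_apply _ b).symm
    have hcoord : ∀ y, ((nodeAut t c τ).1 y).1 s = y.1 s :=
      fun y => nodeFun_of_ne t c y τ hst.ne
    by_cases hx : AgreeAbove s x b'
    · have hx' : AgreeAbove s ((nodeAut t c τ).1 x) b := by rw [hb]; exact hx.nodeAut c τ
      rw [nodeAut_apply s b, nodeAut_apply s b', nodeFun_pos σ hx, nodeFun_pos σ hx', hcoord]
      refine QS.ext fun u => ?_
      by_cases hus : u = s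
      · rw [hus, QS.update_self, hcoord, QS.update_self]
      rw [QS.update_of_ne _ _ hus]
      by_cases hut : u = t
      · subst hut
        have h1 := (x.agreeAbove_update s (σ (x.1 s))).nodeAut (t := u) c τ
        exact (h1 u hst).symm
      · rw [nodeAut_apply, nodeAut_apply, nodeFun_of_ne _ _ _ _ hut, nodeFun_of_ne _ _ _ _ hut,
          QS.update_of_ne _ _ hus]
    · have hx' : ¬ AgreeAbove s ((nodeAut t c τ).1 x) b := by
        intro h
        have := h.nodeAut (t := t) c τ⁻¹
        rw [map_inv, IsoQ.inv_apply_apply] at this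
        exact hx this
      rw [nodeAut_apply s b, nodeAut_apply s b', nodeFun_neg σ hx, nodeFun_neg σ hx']

theorem lexQ_iff {s : S} {x y : QS S} (h : TopDiff s x y) : lexQ S x.1 y.1 ↔ x.1 s < y.1 s := by
  constructor
  · rintro ⟨t, ht, htop⟩
    have : TopDiff t x y := ⟨ht.ne, htop⟩
    rw [h.unique this]
    exact ht
  · exact fun hlt => ⟨s, hlt, h.2⟩

theorem lexQ_irrefl (x : QS S) : ¬ lexQ S x.1 x.1 := fun ⟨_, h, _⟩ => lt_irrefl _ h

theorem lexQ_nodeAut (s : S) (b : QS S) (σ : ℚ ≃o ℚ) (x y : QS S) :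
    lexQ S ((nodeAut s b σ).1 x).1 ((nodeAut s b σ).1 y).1 ↔ lexQ S x.1 y.1 := by
  by_cases hxy : x = y
  · rw [hxy]; exact iff_of_false (lexQ_irrefl _) (lexQ_irrefl _)
  obtain ⟨t, ht⟩ := exists_topDiff hxy
  rw [nodeAut_apply, nodeAut_apply, lexQ_iff ht,
    lexQ_iff (topDiff_nodeFun s b σ.injective t x y ht)]
  by_cases hts : t = s
  · subst hts
    obtain ⟨f, hf, hfx, hfy⟩ := nodeFun_apply_self (b := b) ht.2 σ
    rw [hfx, hfy]
    rcases hf with rfl | rfl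
    exacts [σ.lt_iff_lt, Iff.rfl]
  · rw [nodeFun_of_ne _ _ _ _ hts, nodeFun_of_ne _ _ _ _ hts]

theorem isSTO_lexQ : IsSTO fun x y : QS S => lexQ S x.1 y.1 := by
  refine ⟨lexQ_irrefl, ?_, fun x y => ?_⟩
  · rintro x y z ⟨s, hs, hs'⟩ ⟨t, ht, ht'⟩
    rcases lt_trichotomy s t with h | h | h
    · exact ⟨t, by rw [hs' t h]; exact ht, fun u hu => (hs' u (h.trans hu)).trans (ht' u hu)⟩
    · subst h
      exact ⟨s, hs.trans ht, fun u hu => (hs' u hu).trans (ht' u hu)⟩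
    · exact ⟨s, by rw [← ht' s h]; exact hs, fun u hu => (hs' u hu).trans (ht' u (h.trans hu))⟩
  · by_cases hxy : x = y
    · exact Or.inr (Or.inl hxy)
    obtain ⟨s, hs⟩ := exists_topDiff hxy
    rcases lt_or_gt_of_ne hs.1 with h | h
    · exact Or.inl ⟨s, h, hs.2⟩
    · exact Or.inr (Or.inr ⟨s, h, hs.symm.2⟩)

theorem isConvexSTO_lexQ :
    IsConvexSTO (fun x y : QS S => dQ S x.1 y.1) fun x y : QS S => lexQ S x.1 y.1 := by
  refine ⟨isSTO_lexQ, ?_⟩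
  rintro x y z ⟨s, hs, hs'⟩ ⟨t, ht, ht'⟩
  have h1 : TopDiff s x y := ⟨hs.ne, hs'⟩
  have h2 : TopDiff t y z := ⟨ht.ne, ht'⟩
  simp only [h1.dQ_eq, h2.dQ_eq]
  rcases lt_trichotomy s t with h | h | h
  · rw [(TopDiff.trans_lt h1.symm h2 h).dQ_eq]
    exact ⟨h.le, le_rfl⟩
  · subst h
    have h3 : TopDiff s x z := ⟨(hs.trans ht).ne, h1.2.trans h2.2⟩
    rw [h3.dQ_eq]
    exact ⟨le_rfl, le_rfl⟩
  · rw [(TopDiff.trans_lt h2 h1.symm h).symm.dQ_eq]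
    exact ⟨le_rfl, h.le⟩

open Classical in
/-- The lexicographical ordering as a point of `cLO(Q_S)`. -/
noncomputable def lexC (S : Set ℝ) : cLOQ S :=
  ⟨fun x y => decide (lexQ S x.1 y.1), by simpa using isConvexSTO_lexQ⟩

theorem lexC_eq_true (x y : QS S) : (lexC S).1 x y = true ↔ lexQ S x.1 y.1 := by
  simp [lexC]

theorem cLOQ.ext {r r' : cLOQ S} (h : ∀ x y, r.1 x y = true ↔ r'.1 x y = true) : r = r' :=
  Subtype.ext (funext fun x => funext fun y => Bool.eq_iff_iff.2 (h x y))

theorem cLOQ.eq_true_iff_not {r : cLOQ S} {x y : QS S} (h : x ≠ y) :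
    r.1 x y = true ↔ ¬ r.1 y x = true := by
  obtain ⟨⟨hirr, htr, htri⟩, -⟩ := r.2
  constructor
  · exact fun h1 h2 => hirr _ (htr _ _ _ h1 h2)
  · intro h1
    rcases htri x y with h2 | h2 | h2
    exacts [h2, absurd h2 h, absurd h2 h1]

/-- If `x` and `y` are closer to each other than to `z`, they lie on the same side of `z`. -/
theorem cLOQ.congr_left (r : cLOQ S) {s t : S} {x y z : QS S} (hxy : TopDiff s x y)
    (hxz : TopDiff t x z) (hst : s < t) : r.1 x z = true ↔ r.1 y z = true := by
  have hyz := hxy.trans_lt hxz hst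
  have hconv := r.2.2
  simp only at hconv
  have hlt : ¬ (t : ℝ) ≤ s := not_le.2 hst
  constructor
  · intro h
    by_contra h'
    rw [← cLOQ.eq_true_iff_not hyz.ne.symm] at h'
    have := (hconv _ _ _ h h').1
    rw [hxz.dQ_eq, hxy.dQ_eq] at this
    exact hlt this
  · intro h
    by_contra h'
    rw [← cLOQ.eq_true_iff_not hxz.ne.symm] at h'
    have := (hconv _ _ _ h h').1
    rw [hyz.dQ_eq, hxy.symm.dQ_eq] at this
    exact hlt this

theorem IsoQ.topDiff_iff (g : IsoQ S) {s : S} {x y : QS S} :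
    TopDiff s (g.1 x) (g.1 y) ↔ TopDiff s x y := by
  have key : ∀ (g : IsoQ S) (x y : QS S), TopDiff s x y → TopDiff s (g.1 x) (g.1 y) := by
    intro g x y h
    obtain ⟨t, ht⟩ := exists_topDiff (g.1.injective.ne h.ne)
    have hst : s = t := Subtype.ext (by rw [← h.dQ_eq, ← ht.dQ_eq, g.2])
    rwa [hst]
  refine ⟨fun h => ?_, key g x y⟩
  have := key g⁻¹ _ _ h
  rwa [IsoQ.inv_apply_apply, IsoQ.inv_apply_apply] at this

theorem exists_mem_move (H : Subgroup (IsoQ S)) (hH : ∀ s b σ, nodeAut s b σ ∈ H)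
    (A : Finset (QS S)) (q : QS S) (p : QS S)
    (hp : ∀ a ∈ A, (∀ t, TopDiff t a p ↔ TopDiff t a q) ∧
      (lexQ S a.1 p.1 ↔ lexQ S a.1 q.1) ∧ (lexQ S p.1 a.1 ↔ lexQ S q.1 a.1)) :
    ∃ h ∈ H, (∀ x y, lexQ S (h.1 x).1 (h.1 y).1 ↔ lexQ S x.1 y.1) ∧ (∀ a ∈ A, h.1 a = a) ∧
      h.1 p = q := by
  classical
  induction hn : {t : S | p.1 t ≠ q.1 t}.ncard using Nat.strong_induction_on generalizing p with
  | _ n ih =>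
  by_cases hpq : p = q
  · exact ⟨1, H.one_mem, fun _ _ => Iff.rfl, fun _ _ => rfl, hpq⟩
  obtain ⟨s, hs⟩ := exists_topDiff hpq
  have hA : ∀ a ∈ A, AgreeAbove s a p → TopDiff s a p ∧ TopDiff s a q := by
    intro a ha hap
    have h1 := (hp a ha).1 s
    by_cases h : a.1 s = p.1 s
    · have : TopDiff s a q := ⟨by rw [h]; exact hs.1, hap.trans hs.2⟩
      exact ⟨h1.2 this, this⟩
    · exact ⟨⟨h, hap⟩, h1.1 ⟨h, hap⟩⟩
  obtain ⟨σ, hσ, hσp⟩ := exists_orderIso_of_gap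
    ((A.filter fun a => AgreeAbove s a p).image fun a => a.1 s) (p.1 s) (q.1 s) (by
      intro c hc
      obtain ⟨a, ha, rfl⟩ := Finset.mem_image.1 hc
      obtain ⟨ha, hap⟩ := Finset.mem_filter.1 ha
      obtain ⟨h1, h2⟩ := hA a ha hap
      obtain ⟨-, h3, h4⟩ := hp a ha
      rw [lexQ_iff h1, lexQ_iff h2] at h3
      rw [lexQ_iff h1.symm, lexQ_iff h2.symm] at h4
      exact ⟨h3, h4⟩)
  set k := nodeAut s p σ with hk
  have hkA : ∀ a ∈ A, k.1 a = a := fun a ha => nodeFun_fixes fun hap =>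
    hσ _ (Finset.mem_image_of_mem _ (Finset.mem_filter.2 ⟨ha, hap⟩))
  have hkp : k.1 p = p.update s (q.1 s) := by
    rw [hk, nodeAut_apply, nodeFun_pos _ (AgreeAbove.refl s p), hσp]
  have hlt : {t : S | (k.1 p).1 t ≠ q.1 t}.ncard < n := by
    rw [← hn]
    refine Set.ncard_lt_ncard ⟨fun t ht => ?_, fun hsub => ?_⟩ (finite_ne p q)
    · change (k.1 p).1 t ≠ q.1 t at ht
      by_cases hts : t = s
      · subst hts
        exact hs.1
      · rwa [hkp, QS.update_of_ne _ _ hts] at ht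
    · have : (k.1 p).1 s ≠ q.1 s := hsub hs.1
      rw [hkp, QS.update_self] at this
      exact this rfl
  obtain ⟨h, hhH, hlex, hfix, hhp⟩ := ih _ hlt (k.1 p) (fun a ha => by
    obtain ⟨h1, h2, h3⟩ := hp a ha
    rw [← h2, ← h3, ← lexQ_nodeAut s p σ a p, ← lexQ_nodeAut s p σ p a, ← hk, hkA a ha]
    refine ⟨fun t => ?_, Iff.rfl, Iff.rfl⟩
    rw [← h1 t, ← k.topDiff_iff (x := a) (y := p), hkA a ha]) rfl
  refine ⟨h * k, H.mul_mem hhH (hH _ _ _), fun x y => ?_, fun a ha => ?_, hhp⟩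
  · rw [IsoQ.mul_apply, IsoQ.mul_apply, hlex]
    exact lexQ_nodeAut s p σ x y
  · rw [IsoQ.mul_apply, hkA a ha, hfix a ha]

theorem exists_mem_extending {ι : Type*} (H : Subgroup (IsoQ S))
    (hH : ∀ s b σ, nodeAut s b σ ∈ H) (I : Finset ι) (u v : ι → QS S)
    (huv : ∀ i ∈ I, ∀ j ∈ I, (∀ t, TopDiff t (u i) (u j) ↔ TopDiff t (v i) (v j)) ∧
      (lexQ S (u i).1 (u j).1 ↔ lexQ S (v i).1 (v j).1)) :
    ∃ h ∈ H, (∀ x y, lexQ S (h.1 x).1 (h.1 y).1 ↔ lexQ S x.1 y.1) ∧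
      ∀ i ∈ I, h.1 (u i) = v i := by
  classical
  induction I using Finset.induction_on with
  | empty => exact ⟨1, H.one_mem, fun _ _ => Iff.rfl, by simp⟩
  | insert i I _ ih =>
    obtain ⟨h, hhH, hlex, hu⟩ := ih fun i hi j hj =>
      huv i (Finset.mem_insert_of_mem hi) j (Finset.mem_insert_of_mem hj)
    obtain ⟨k, hkH, hklex, hkfix, hk⟩ := exists_mem_move H hH (I.image v) (v i) (h.1 (u i)) (by
      intro a ha
      obtain ⟨j, hj, rfl⟩ := Finset.mem_image.1 ha
      rw [← hu j hj, hlex, hlex, hu j hj]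
      refine ⟨fun t => ?_, (huv _ (Finset.mem_insert_of_mem hj) _ (Finset.mem_insert_self _ _)).2,
        (huv _ (Finset.mem_insert_self _ _) _ (Finset.mem_insert_of_mem hj)).2⟩
      rw [← hu j hj, h.topDiff_iff, hu j hj]
      exact (huv _ (Finset.mem_insert_of_mem hj) _ (Finset.mem_insert_self _ _)).1 t)
    refine ⟨k * h, H.mul_mem hkH hhH, fun x y => ?_, fun j hj => ?_⟩
    · rw [IsoQ.mul_apply, IsoQ.mul_apply, hklex, hlex]
    · rw [IsoQ.mul_apply]
      rcases Finset.mem_insert.1 hj with rfl | hj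
      · exact hk
      · rw [hu j hj, hkfix _ (Finset.mem_image_of_mem _ hj)]

/-- A convex ordering agreeing with the lexicographical one on `A` can be made to agree with it
on one more point by an isometry fixing `A`. -/
theorem exists_fixing_lexQ_iff (r : cLOQ S) (A : Finset (QS S))
    (hA : ∀ a ∈ A, ∀ b ∈ A, r.1 a b = true ↔ lexQ S a.1 b.1) (p : QS S) (hpA : p ∉ A) :
    ∃ k : IsoQ S, (∀ a ∈ A, k.1 a = a) ∧
      ∀ a ∈ A, r.1 p a = true ↔ lexQ S (k.1 p).1 a.1 := by
  classical
  rcases A.eq_empty_or_nonempty with rfl | hne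
  · exact ⟨1, by simp, by simp⟩
  obtain ⟨a₀, ha₀, hmin⟩ := A.exists_min_image (fun a => dQ S p.1 a.1) hne
  have hpne : ∀ a ∈ A, p ≠ a := fun a ha h => hpA (h ▸ ha)
  obtain ⟨s, hs⟩ := exists_topDiff (hpne a₀ ha₀)
  have hclose : ∀ a ∈ A, ∀ t, TopDiff t p a → s ≤ t := by
    intro a ha t ht
    have := hmin a ha
    rwa [hs.dQ_eq, ht.dQ_eq] at this
  have htop : ∀ a ∈ A, AgreeAbove s a p → TopDiff s p a := by
    intro a ha hap
    obtain ⟨t, ht⟩ := exists_topDiff (hpne a ha)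
    have hts : t ≤ s := not_lt.1 fun h => ht.1 (hap t h).symm
    rwa [le_antisymm (hclose a ha t ht) hts]
  let N := A.filter fun a => AgreeAbove s a p
  obtain ⟨q, hqL, hqR⟩ := Order.exists_between_finsets
    ((N.filter fun a => r.1 a p = true).image fun a => a.1 s)
    ((N.filter fun a => r.1 p a = true).image fun a => a.1 s) (by
      intro x hx y hy
      obtain ⟨a, ha, rfl⟩ := Finset.mem_image.1 hx
      obtain ⟨b, hb, rfl⟩ := Finset.mem_image.1 hy
      obtain ⟨ha, hap⟩ := Finset.mem_filter.1 ha
      obtain ⟨hb, hpb⟩ := Finset.mem_filter.1 hb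
      obtain ⟨ha, hap'⟩ := Finset.mem_filter.1 ha
      obtain ⟨hb, hbp'⟩ := Finset.mem_filter.1 hb
      have hab : r.1 a b = true := r.2.1.2.1 _ _ _ hap hpb
      have hab' : a ≠ b := by
        rintro rfl
        exact r.2.1.1 _ hab
      obtain ⟨t, ht⟩ := exists_topDiff hab'
      have hts : t ≤ s := not_lt.1 fun h => ht.1 ((hap'.trans hbp'.symm) t h)
      have hst : s ≤ t := by
        have h1 := (r.2.2 _ _ _ hap hpb).1
        simp only at h1
        rwa [(htop a ha hap').symm.dQ_eq, ht.dQ_eq] at h1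
      rw [← le_antisymm hts hst]
      rwa [hA a ha b hb, lexQ_iff ht] at hab)
  have hqN : ∀ a ∈ A, AgreeAbove s a p → (r.1 p a = true ↔ q < a.1 s) ∧ a.1 s ≠ q := by
    intro a ha hap
    have haN : a ∈ N := Finset.mem_filter.2 ⟨ha, hap⟩
    by_cases h : r.1 p a = true
    · have := hqR _ (Finset.mem_image_of_mem _ (Finset.mem_filter.2 ⟨haN, h⟩))
      exact ⟨iff_of_true h this, this.ne'⟩
    · have := hqL _ (Finset.mem_image_of_mem _ (Finset.mem_filter.2
        ⟨haN, (cLOQ.eq_true_iff_not (hpne a ha).symm).2 h⟩))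
      exact ⟨iff_of_false h this.not_gt, this.ne⟩
  set k := nodePerm s p (Equiv.swap (p.1 s) q) with hk
  have hkA : ∀ a ∈ A, k.1 a = a := fun a ha => nodeFun_fixes fun hap =>
    Equiv.swap_apply_of_ne_of_ne (htop a ha hap).1.symm (hqN a ha hap).2
  have hkp : k.1 p = p.update s q := by
    rw [hk, nodePerm_apply, nodeFun_pos _ (AgreeAbove.refl s p), Equiv.swap_apply_left]
  refine ⟨k, hkA, fun a ha => ?_⟩
  by_cases hap : AgreeAbove s a p
  · have h1 : TopDiff s (k.1 p) a := by
      rw [← hkA a ha, k.topDiff_iff]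
      exact htop a ha hap
    rw [lexQ_iff h1, hkp, QS.update_self]
    exact (hqN a ha hap).1
  · obtain ⟨t, ht⟩ := exists_topDiff (hpne a ha)
    have hst : s < t := lt_of_le_of_ne (hclose a ha t ht) fun h => by
      subst h
      exact hap ht.2.symm
    have hs' : TopDiff s (k.1 p) a₀ := by
      rw [← hkA a₀ ha₀, k.topDiff_iff]
      exact hs
    have ht' : TopDiff t (k.1 p) a := by
      rw [← hkA a ha, k.topDiff_iff]
      exact ht
    rw [r.congr_left hs ht hst, hA a₀ ha₀ a ha, ← lexC_eq_true, ← lexC_eq_true,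
      (lexC S).congr_left hs' ht' hst]

theorem exists_isoQ_lexQ_iff (r : cLOQ S) (A : Finset (QS S)) :
    ∃ g : IsoQ S, ∀ a ∈ A, ∀ b ∈ A, r.1 a b = true ↔ lexQ S (g.1 a).1 (g.1 b).1 := by
  classical
  induction A using Finset.induction_on with
  | empty => exact ⟨1, by simp⟩
  | insert p A hp ih =>
    obtain ⟨g, hg⟩ := ih
    have hact : ∀ x y, (actQ S g r).1 (g.1 x) (g.1 y) = r.1 x y := fun x y => by
      change r.1 (g⁻¹.1 (g.1 x)) (g⁻¹.1 (g.1 y)) = _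
      rw [IsoQ.inv_apply_apply, IsoQ.inv_apply_apply]
    obtain ⟨k, hkA, hk⟩ := exists_fixing_lexQ_iff (actQ S g r) (A.image g.1) (by
      intro a ha b hb
      obtain ⟨a, haA, rfl⟩ := Finset.mem_image.1 ha
      obtain ⟨b, hbA, rfl⟩ := Finset.mem_image.1 hb
      rw [hact]
      exact hg a haA b hbA) (g.1 p) (by simpa using hp)
    have hkA' : ∀ a ∈ A, k.1 (g.1 a) = g.1 a := fun a ha => hkA _ (Finset.mem_image_of_mem _ ha)
    have hleft : ∀ a ∈ A, r.1 p a = true ↔ lexQ S (k.1 (g.1 p)).1 (k.1 (g.1 a)).1 := by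
      intro a ha
      have := hk _ (Finset.mem_image_of_mem _ ha)
      rwa [hact, ← hkA' a ha] at this
    refine ⟨k * g, fun a ha b hb => ?_⟩
    simp only [IsoQ.mul_apply]
    rcases Finset.mem_insert.1 ha with rfl | haA <;> rcases Finset.mem_insert.1 hb with rfl | hbA
    · exact iff_of_false (r.2.1.1 _) (lexQ_irrefl _)
    · exact hleft b hbA
    · have hne : a ≠ b := fun h => hp (h ▸ haA)
      rw [cLOQ.eq_true_iff_not hne, hleft a haA, ← lexC_eq_true, ← lexC_eq_true,
        cLOQ.eq_true_iff_not (k.1.injective.ne (g.1.injective.ne hne))]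
    · rw [hkA' a haA, hkA' b hbA]
      exact hg a haA b hbA

instance : DiscreteTopology (QS S) := ⟨rfl⟩

theorem exists_finset_of_mem_nhds_one {V : Set (IsoQ S)} (hV : V ∈ nhds (1 : IsoQ S)) :
    ∃ A : Finset (QS S), ∀ g : IsoQ S, (∀ a ∈ A, g.1 a = a) → g ∈ V := by
  rw [nhds_induced, Filter.mem_comap] at hV
  obtain ⟨W, hW, hWV⟩ := hV
  obtain ⟨W₁, hW₁, W₂, hW₂, hsub⟩ := mem_nhds_prod_iff.1 hW
  have key : ∀ W ∈ nhds (id : QS S → QS S), ∃ A : Finset (QS S), ∀ f : QS S → QS S,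
      (∀ a ∈ A, f a = a) → f ∈ W := by
    intro W hW
    rw [nhds_pi, Filter.mem_pi'] at hW
    obtain ⟨A, t, ht, hA⟩ := hW
    refine ⟨A, fun f hf => hA fun a ha => ?_⟩
    rw [hf a ha]
    exact mem_of_mem_nhds (ht a)
  obtain ⟨A₁, hA₁⟩ := key W₁ hW₁
  obtain ⟨A₂, hA₂⟩ := key W₂ hW₂
  classical
  refine ⟨A₁ ∪ A₂, fun g hg => hWV (hsub ⟨hA₁ _ fun a ha => hg a (Finset.mem_union_left _ ha),
    hA₂ _ fun a ha => ?_⟩)⟩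
  exact g.1.symm_apply_eq.2 (hg a (Finset.mem_union_right _ ha)).symm

open Uniformity in
theorem exists_finset_smul_near {X : Type*} [UniformSpace X] [CompactSpace X]
    [MulAction (IsoQ S) X] [ContinuousSMul (IsoQ S) X] {U : Set (X × X)} (hU : U ∈ 𝓤 X) :
    ∃ A : Finset (QS S), ∀ g : IsoQ S, (∀ a ∈ A, g.1 a = a) → ∀ x : X, (g • x, x) ∈ U := by
  have h : ∀ᶠ g in nhds (1 : IsoQ S), ∀ x ∈ (Set.univ : Set X), (g • x, x) ∈ U := by
    refine isCompact_univ.eventually_forall_of_forall_eventually fun x _ => ?_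
    have hc : Continuous fun z : IsoQ S × X => (z.1 • z.2, z.2) := by fun_prop
    have : Filter.Tendsto (fun z : IsoQ S × X => (z.1 • z.2, z.2)) (nhds (1, x)) (nhds (x, x)) := by
      have := hc.tendsto (1, x)
      simpa using this
    exact this.eventually (nhds_le_uniformity x hU)
  obtain ⟨A, hA⟩ := exists_finset_of_mem_nhds_one h
  exact ⟨A, fun g hg x => hA g hg x (Set.mem_univ x)⟩

section FixedPoint

variable {X : Type*} [MulAction (IsoQ S) X]

variable (X) in
/-- The points of `X` fixed by all `nodeAut s b σ`. -/
def nodeFixed (s : S) (b : QS S) : Set X := {x | ∀ σ, nodeAut s b σ • x = x}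

theorem smul_mem_nodeFixed_of_eq {s : S} (b c : QS S) (σ : ℚ ≃o ℚ) {x : X}
    (hx : x ∈ nodeFixed X s b) : nodeAut s c σ • x ∈ nodeFixed X s b := by
  by_cases h : AgreeAbove s b c
  · rwa [← nodeAut_eq_of_agreeAbove h, hx σ]
  · intro τ
    rw [smul_smul, nodeAut_mul_of_not_agreeAbove h, ← smul_smul, hx τ]

theorem smul_mem_iInter_nodeFixed_of_lt {s t : S} (hst : s < t) (c : QS S) (σ : ℚ ≃o ℚ) {x : X}
    (hx : x ∈ ⋂ b, nodeFixed X s b) : nodeAut t c σ • x ∈ ⋂ b, nodeFixed X s b := by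
  refine Set.mem_iInter.2 fun b τ => ?_
  rw [smul_smul, nodeAut_mul_nodeAut_of_lt hst, ← smul_smul, Set.mem_iInter.1 hx _ τ]

variable [TopologicalSpace X] [T2Space X] [ContinuousSMul (IsoQ S) X]

theorem isClosed_nodeFixed (s : S) (b : QS S) : IsClosed (nodeFixed X s b) := by
  simp only [nodeFixed, Set.ofPred_forall]
  exact isClosed_iInter fun σ => isClosed_eq (continuous_const_smul _) continuous_id

variable [CompactSpace X]

theorem exists_fixed_nodeAut {Y : Set X} (hY : IsClosed Y) (hne : Y.Nonempty) (s : S) (b : QS S)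
    (hinv : ∀ σ, ∀ y ∈ Y, nodeAut s b σ • y ∈ Y) : ∃ y ∈ Y, ∀ σ, nodeAut s b σ • y = y := by
  classical
  let _ : UniformSpace X := uniformSpaceOfCompactR1
  refine exists_fixed_of_orderIso_action (nodeAut s b) (fun U hU => ?_) hY hne hinv
  obtain ⟨A, hA⟩ := exists_finset_smul_near (S := S) hU
  exact ⟨A.image fun a => a.1 s, fun σ hσ => hA _ fun a ha => nodeFun_fixes fun _ =>
    hσ _ (Finset.mem_image_of_mem _ ha)⟩

theorem inter_iInter_nodeFixed_nonempty {Y : Set X} (hY : IsClosed Y) (hne : Y.Nonempty) (s : S)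
    (hinv : ∀ b σ, ∀ y ∈ Y, nodeAut s b σ • y ∈ Y) : (Y ∩ ⋂ b, nodeFixed X s b).Nonempty := by
  classical
  refine hY.isCompact.inter_iInter_nonempty _ (isClosed_nodeFixed s) fun u => ?_
  induction u using Finset.induction_on with
  | empty => simpa using hne
  | insert b u _ ih =>
    have hcl : IsClosed (Y ∩ ⋂ c ∈ u, nodeFixed X s c) :=
      hY.inter (isClosed_biInter fun c _ => isClosed_nodeFixed s c)
    obtain ⟨y, ⟨hyY, hyu⟩, hy⟩ := exists_fixed_nodeAut hcl ih s b fun σ y hy =>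
      ⟨hinv b σ y hy.1, Set.mem_iInter₂.2 fun c hc =>
        smul_mem_nodeFixed_of_eq c b σ (Set.mem_iInter₂.1 hy.2 c hc)⟩
    refine ⟨y, hyY, ?_⟩
    rw [Finset.set_biInter_insert]
    exact ⟨hy, hyu⟩

theorem exists_fixed_all {Y : Set X} (hY : IsClosed Y) (hne : Y.Nonempty)
    (hinv : ∀ g : IsoQ S, ∀ y ∈ Y, g • y ∈ Y) :
    ∃ y ∈ Y, ∀ (s : S) b σ, nodeAut s b σ • y = y := by
  have key : (Y ∩ ⋂ s : S, ⋂ b, nodeFixed X s b).Nonempty := by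
    refine hY.isCompact.inter_iInter_nonempty _
      (fun s => isClosed_iInter (isClosed_nodeFixed (X := X) s)) fun F => ?_
    induction F using Finset.induction_on_max with
    | empty => simpa using hne
    | insert t F hF ih =>
      have hcl : IsClosed (Y ∩ ⋂ s ∈ F, ⋂ b : QS S, nodeFixed X s b) :=
        hY.inter (isClosed_biInter fun s _ => isClosed_iInter (isClosed_nodeFixed s))
      obtain ⟨y, ⟨hyY, hyF⟩, hy⟩ := inter_iInter_nodeFixed_nonempty hcl ih t fun b σ y hy =>
        ⟨hinv _ y hy.1, Set.mem_iInter₂.2 fun s hs =>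
          smul_mem_iInter_nodeFixed_of_lt (hF s hs) b σ (Set.mem_iInter₂.1 hy.2 s hs)⟩
      refine ⟨y, hyY, ?_⟩
      rw [Finset.set_biInter_insert]
      exact ⟨hy, hyF⟩
  obtain ⟨y, hyY, hy⟩ := key
  exact ⟨y, hyY, fun s b => Set.mem_iInter.1 (Set.mem_iInter.1 hy s) b⟩

end FixedPoint

noncomputable instance : MulAction (IsoQ S) (cLOQ S) where
  smul g r := actQ S g r
  one_smul _ := rfl
  mul_smul _ _ _ := rfl

theorem smul_apply_cLOQ (g : IsoQ S) (r : cLOQ S) (x y : QS S) :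
    (g • r).1 x y = r.1 (g⁻¹.1 x) (g⁻¹.1 y) := rfl

theorem isInducing_cLOQ : Topology.IsInducing (fun r : cLOQ S => r.1) := ⟨rfl⟩

theorem continuous_cLOQ_apply (x y : QS S) : Continuous fun r : cLOQ S => r.1 x y :=
  (continuous_apply_apply x y).comp isInducing_cLOQ.continuous

theorem continuous_symm_apply (x : QS S) : Continuous fun g : IsoQ S => g.1.symm x :=
  have h : Continuous fun g : IsoQ S => ((g.1 : QS S → QS S), (g.1.symm : QS S → QS S)) :=
    continuous_induced_dom
  (continuous_apply x).comp (continuous_snd.comp h)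

instance : ContinuousSMul (IsoQ S) (cLOQ S) where
  continuous_smul := by
    refine isInducing_cLOQ.continuous_iff.2 (continuous_pi fun x => continuous_pi fun y => ?_)
    have h : Continuous fun p : (QS S × QS S) × cLOQ S => p.2.1 p.1.1 p.1.2 :=
      continuous_prod_of_discrete_left.2 fun a => continuous_cLOQ_apply a.1 a.2
    exact h.comp ((((continuous_symm_apply x).comp continuous_fst).prodMk
      ((continuous_symm_apply y).comp continuous_fst)).prodMk continuous_snd)

instance : T2Space (cLOQ S) :=
  inferInstanceAs (T2Space {r : QS S → QS S → Bool //
    IsConvexSTO (fun x y : QS S => dQ S x.1 y.1) (fun x y => r x y = true)})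

instance : CompactSpace (cLOQ S) := by
  refine isCompact_iff_compactSpace.1 (IsClosed.isCompact (X := QS S → QS S → Bool)
    (s := {r | IsConvexSTO (fun x y : QS S => dQ S x.1 y.1) (fun x y => r x y = true)}) ?_)
  have hcl : ∀ (x y : QS S) (A : Set Bool), IsClosed {r : QS S → QS S → Bool | r x y ∈ A} :=
    fun x y A => (isClosed_discrete A).preimage (continuous_apply_apply x y)
  have hop : ∀ (x y : QS S) (A : Set Bool), IsOpen {r : QS S → QS S → Bool | r x y ∈ A} :=
    fun x y A => (isOpen_discrete A).preimage (continuous_apply_apply x y)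
  simp only [IsConvexSTO, IsSTO, Set.ofPred_and, Set.ofPred_forall]
  refine ((isClosed_iInter fun x => hcl x x {true}ᶜ).inter
    ((isClosed_iInter fun x => isClosed_iInter fun y => isClosed_iInter fun z =>
      isClosed_imp (hop x y {true}) (isClosed_imp (hop y z {true}) (hcl x z {true}))).inter
    (isClosed_iInter fun x => isClosed_iInter fun y => (hcl x y {true}).union
      (isClosed_const.union (hcl y x {true}))))).inter
    (isClosed_iInter fun x => isClosed_iInter fun y => isClosed_iInter fun z =>
      isClosed_imp (hop x y {true}) (isClosed_imp (hop y z {true}) isClosed_const))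

theorem exists_finset_of_mem_nhds_cLOQ {r : cLOQ S} {W : Set (cLOQ S)} (hW : W ∈ nhds r) :
    ∃ A : Finset (QS S), ∀ r' : cLOQ S,
      (∀ a ∈ A, ∀ b ∈ A, r'.1 a b = true ↔ r.1 a b = true) → r' ∈ W := by
  classical
  rw [isInducing_cLOQ.nhds_eq_comap, Filter.mem_comap] at hW
  obtain ⟨W', hW', hsub⟩ := hW
  rw [nhds_pi, Filter.mem_pi'] at hW'
  obtain ⟨A, t, ht, hA⟩ := hW'
  have h : ∀ a, ∃ B : Finset (QS S), ∀ f : QS S → Bool, (∀ b ∈ B, f b = r.1 a b) → f ∈ t a := by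
    intro a
    have := ht a
    rw [nhds_pi, Filter.mem_pi'] at this
    obtain ⟨B, u, hu, hB⟩ := this
    refine ⟨B, fun f hf => hB fun b hb => ?_⟩
    rw [hf b hb]
    exact mem_of_mem_nhds (hu b)
  choose B hB using h
  refine ⟨A ∪ A.biUnion B, fun r' hr' => hsub (hA fun a ha => hB a _ fun b hb => ?_)⟩
  exact Bool.eq_iff_iff.2 (hr' a (Finset.mem_union_left _ ha) b
    (Finset.mem_union_right _ (Finset.mem_biUnion.2 ⟨a, ha, hb⟩)))

theorem eventually_cLOQ_eq (r : cLOQ S) (A : Finset (QS S)) :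
    ∀ᶠ r' in nhds r, ∀ a ∈ A, ∀ b ∈ A, r'.1 a b = r.1 a b :=
  (Finset.eventually_all _).2 fun a _ => (Finset.eventually_all _).2 fun b _ =>
    (continuous_cLOQ_apply a b).continuousAt.eventually
      (IsOpen.mem_nhds (isOpen_discrete {r.1 a b}) rfl)

theorem dense_orbit_lexC : Dense (Set.range fun g : IsoQ S => g • lexC S) := by
  intro r
  refine mem_closure_iff_nhds.2 fun W hW => ?_
  obtain ⟨A, hA⟩ := exists_finset_of_mem_nhds_cLOQ hW
  obtain ⟨g, hg⟩ := exists_isoQ_lexQ_iff r A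
  refine ⟨g⁻¹ • lexC S, hA _ fun a ha b hb => ?_, ⟨g⁻¹, rfl⟩⟩
  rw [smul_apply_cLOQ, inv_inv, lexC_eq_true, hg a ha b hb]

open Classical in
/-- The isometry changing the sign of the coordinates in `E`. -/
noncomputable def coordFlip (E : Set S) : IsoQ S :=
  let f : QS S → QS S := fun x => ⟨fun s => if s ∈ E then - x.1 s else x.1 s,
    x.2.subset fun s hs h => hs (by simp [h])⟩
  have hf : ∀ x, f (f x) = x := fun x => QS.ext fun s => by
    by_cases h : s ∈ E <;> simp [f, h]
  have key : ∀ x y s, (f x).1 s = (f y).1 s ↔ x.1 s = y.1 s := fun x y s => by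
    by_cases h : s ∈ E <;> simp [f, h]
  IsoQ.ofTopDiff ⟨f, f, hf, hf⟩ fun s x y h =>
    ⟨fun e => h.1 ((key x y s).1 e), fun t ht => (key x y t).2 (h.2 t ht)⟩

theorem coordFlip_apply_of_mem {E : Set S} {s : S} (h : s ∈ E) (x : QS S) :
    ((coordFlip E).1 x).1 s = - x.1 s := if_pos h

theorem coordFlip_apply_of_notMem {E : Set S} {s : S} (h : s ∉ E) (x : QS S) :
    ((coordFlip E).1 x).1 s = x.1 s := if_neg h

/-- A convex ordering fixed by the order automorphisms of the nodes is the lexicographical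
ordering up to reversing some coordinates. -/
theorem exists_smul_eq_lexC (r : cLOQ S) (hr : ∀ (s : S) b σ, nodeAut s b σ • r = r) :
    ∃ g : IsoQ S, g • r = lexC S := by
  let H := MulAction.stabilizer (IsoQ S) r
  have hsame : ∀ (s : S) (x y x' y' : QS S), TopDiff s x y → TopDiff s x' y' →
      x.1 s < y.1 s → x'.1 s < y'.1 s → (r.1 x y = true ↔ r.1 x' y' = true) := by
    intro s x y x' y' h h' hlt hlt'
    obtain ⟨g, hgH, -, hg⟩ := exists_mem_extending H hr Finset.univ
      (fun b : Bool => if b then x else y) (fun b => if b then x' else y') (by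
        have e1 : ∀ t, TopDiff t x y ↔ TopDiff t x' y' := fun t =>
          ⟨fun h1 => by rwa [h1.unique h], fun h1 => by rwa [h1.unique h']⟩
        have e2 : ∀ t, TopDiff t y x ↔ TopDiff t y' x' := fun t =>
          ⟨fun h1 => ((e1 t).1 h1.symm).symm, fun h1 => ((e1 t).2 h1.symm).symm⟩
        have e3 : ∀ (t : S) (z : QS S), ¬ TopDiff t z z := fun t z h => h.ne rfl
        intro i _ j _
        cases i <;> cases j <;>
          simp [e1, e2, e3, lexQ_irrefl, lexQ_iff h, lexQ_iff h', lexQ_iff h.symm,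
            lexQ_iff h'.symm, hlt, hlt', hlt.not_gt, hlt'.not_gt])
    have hx : g.1 x = x' := by simpa using hg true (Finset.mem_univ _)
    have hy : g.1 y = y' := by simpa using hg false (Finset.mem_univ _)
    have hgr : g • r = r := hgH
    rw [← hx, ← hy]
    conv_rhs => rw [← hgr, smul_apply_cLOQ, IsoQ.inv_apply_apply, IsoQ.inv_apply_apply]
  let E : Set S := {s | ∃ x y, TopDiff s x y ∧ x.1 s < y.1 s ∧ ¬ r.1 x y = true}
  refine ⟨(coordFlip E)⁻¹, cLOQ.ext fun x y => ?_⟩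
  rw [smul_apply_cLOQ, inv_inv, lexC_eq_true]
  by_cases hxy : x = y
  · rw [hxy]
    exact iff_of_false (r.2.1.1 _) (lexQ_irrefl _)
  obtain ⟨s, hs⟩ := exists_topDiff hxy
  have hs' : TopDiff s ((coordFlip E).1 x) ((coordFlip E).1 y) := (coordFlip E).topDiff_iff.2 hs
  rw [lexQ_iff hs]
  by_cases hE : s ∈ E
  · have hneg : ∀ z w, TopDiff s z w → z.1 s < w.1 s → ¬ r.1 z w = true := by
      obtain ⟨x', y', h1, h2, h3⟩ := hE
      intro z w hzw hlt
      rwa [hsame s z w x' y' hzw h1 hlt h2]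
    rcases lt_or_gt_of_ne hs'.1 with h | h
    · have h' := h
      rw [coordFlip_apply_of_mem hE, coordFlip_apply_of_mem hE, neg_lt_neg_iff] at h'
      exact iff_of_false (hneg _ _ hs' h) h'.not_gt
    · have h' := h
      rw [coordFlip_apply_of_mem hE, coordFlip_apply_of_mem hE, neg_lt_neg_iff] at h'
      exact iff_of_true ((cLOQ.eq_true_iff_not hs'.ne).2 (hneg _ _ hs'.symm h)) h'
  · have hpos : ∀ z w, TopDiff s z w → z.1 s < w.1 s → r.1 z w = true := by
      intro z w hzw hlt
      by_contra h
      exact hE ⟨z, w, hzw, hlt, h⟩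
    rw [← coordFlip_apply_of_notMem hE x, ← coordFlip_apply_of_notMem hE y]
    rcases lt_or_gt_of_ne hs'.1 with h | h
    · exact iff_of_true (hpos _ _ hs' h) h
    · exact iff_of_false ((cLOQ.eq_true_iff_not hs'.symm.ne).1 (hpos _ _ hs'.symm h)) h.not_gt

theorem dense_orbit_cLOQ (r : cLOQ S) : Dense (Set.range fun g : IsoQ S => g • r) := by
  set Z := closure (Set.range fun g : IsoQ S => g • r) with hZ
  have hinv : ∀ g : IsoQ S, ∀ z ∈ Z, g • z ∈ Z := fun g z hz =>
    map_mem_closure (continuous_const_smul g) hz (by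
      rintro _ ⟨h, rfl⟩
      exact ⟨g * h, mul_smul g h r⟩)
  obtain ⟨ρ, hρZ, hρ⟩ := exists_fixed_all (S := S) isClosed_closure
    (Set.range_nonempty _).closure hinv
  obtain ⟨g, hg⟩ := exists_smul_eq_lexC ρ hρ
  have hlex : lexC S ∈ Z := hg ▸ hinv g ρ hρZ
  refine dense_iff_closure_eq.2 (Set.eq_univ_of_univ_subset ?_)
  rw [← dense_orbit_lexC.closure_eq]
  refine closure_minimal ?_ isClosed_closure
  rintro _ ⟨h, rfl⟩
  exact hinv h _ hlex

open Uniformity in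
theorem exists_equivariant_surjection (X : Type*) [TopologicalSpace X] [CompactSpace X]
    [T2Space X] [Nonempty X] [MulAction (IsoQ S) X] [ContinuousSMul (IsoQ S) X]
    (hmin : ∀ x : X, Dense (Set.range fun g : IsoQ S => g • x)) :
    ∃ π : cLOQ S → X, Continuous π ∧ Function.Surjective π ∧
      ∀ (g : IsoQ S) (r : cLOQ S), π (g • r) = g • π r := by
  classical
  let _ : UniformSpace X := uniformSpaceOfCompactR1
  obtain ⟨x₀, -, hx₀⟩ := exists_fixed_all (S := S) (X := X) isClosed_univ Set.univ_nonempty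
    fun _ _ _ => Set.mem_univ _
  let Γ₀ : Set (cLOQ S × X) := Set.range fun g : IsoQ S => (g • lexC S, g • x₀)
  let Γ := closure Γ₀
  have hΓ : IsCompact Γ := isClosed_closure.isCompact
  have hinv : ∀ (g : IsoQ S) r x, (r, x) ∈ Γ → (g • r, g • x) ∈ Γ := fun g r x h =>
    map_mem_closure (f := fun z : cLOQ S × X => (g • z.1, g • z.2)) (by fun_prop) h (by
      rintro _ ⟨h, rfl⟩
      exact ⟨g * h, by simp only [mul_smul]⟩)
  have htotal : ∀ r, ∃ x, (r, x) ∈ Γ := by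
    have hcl : IsClosed (Prod.fst '' Γ) := (hΓ.image continuous_fst).isClosed
    have hsub : (Set.range fun g : IsoQ S => g • lexC S) ⊆ Prod.fst '' Γ := by
      rintro _ ⟨g, rfl⟩
      exact ⟨_, subset_closure ⟨g, rfl⟩, rfl⟩
    intro r
    obtain ⟨⟨r', x⟩, hx, rfl⟩ := closure_minimal hsub hcl (dense_orbit_lexC r)
    exact ⟨x, hx⟩
  have huniq : ∀ r x x', (r, x) ∈ Γ → (r, x') ∈ Γ → x = x' := by
    intro r x x' hx hx'
    refine eq_of_uniformity fun {U} hU => ?_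
    obtain ⟨W, hW, -, hWU⟩ := comp_symm_mem_uniformity_sets hU
    obtain ⟨V, hV, hVsymm, hVW⟩ := comp_symm_mem_uniformity_sets hW
    obtain ⟨A, hA⟩ := exists_finset_smul_near (S := S) hV
    have happrox : ∀ x, (r, x) ∈ Γ → ∃ g : IsoQ S,
        (∀ a ∈ A, ∀ b ∈ A, (g • lexC S).1 a b = r.1 a b) ∧ (x, g • x₀) ∈ V := by
      intro x hx
      obtain ⟨_, ⟨h1, h2⟩, g, rfl⟩ := mem_closure_iff_nhds.1 hx _
        (prod_mem_nhds (eventually_cLOQ_eq r A) (mem_nhds_left x hV))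
      exact ⟨g, h1, h2⟩
    obtain ⟨g, hg, hgx⟩ := happrox x hx
    obtain ⟨g', hg', hgx'⟩ := happrox x' hx'
    obtain ⟨h, hhH, -, hh⟩ := exists_mem_extending (MulAction.stabilizer (IsoQ S) x₀) hx₀ A
      (fun a => g⁻¹.1 a) (fun a => g'⁻¹.1 a) fun a ha b hb => by
        refine ⟨fun t => by rw [g⁻¹.topDiff_iff, g'⁻¹.topDiff_iff], ?_⟩
        have := (hg a ha b hb).trans (hg' a ha b hb).symm
        rwa [smul_apply_cLOQ, smul_apply_cLOQ, Bool.eq_iff_iff, lexC_eq_true, lexC_eq_true] at this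
    have hfix : ∀ a ∈ A, (g' * h * g⁻¹).1 a = a := fun a ha => by
      rw [IsoQ.mul_apply, IsoQ.mul_apply, hh a ha, IsoQ.apply_inv_apply]
    have hnear := hA _ hfix (g • x₀)
    have hhx : h • x₀ = x₀ := hhH
    rw [smul_smul, inv_mul_cancel_right, mul_smul, hhx] at hnear
    exact hWU ⟨g • x₀, hVW ⟨_, hgx, refl_mem_uniformity hV⟩, hVW ⟨_, SetRel.symm V hnear,
      SetRel.symm V hgx'⟩⟩
  choose π hπ using htotal
  have hπeq : ∀ r x, (r, x) ∈ Γ → π r = x := fun r x h => huniq r _ _ (hπ r) h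
  have hcont : Continuous π := continuous_iff_isClosed.2 fun C hC => by
    have : π ⁻¹' C = Prod.fst '' (Γ ∩ Prod.snd ⁻¹' C) := by
      ext r
      constructor
      · exact fun h => ⟨(r, π r), ⟨hπ r, h⟩, rfl⟩
      · rintro ⟨⟨r', x⟩, ⟨h1, h2⟩, rfl⟩
        exact (hπeq _ _ h1).symm ▸ h2
    rw [this]
    exact ((hΓ.inter_right (hC.preimage continuous_snd)).image continuous_fst).isClosed
  refine ⟨π, hcont, fun x => ?_, fun g r => hπeq _ _ (hinv g r _ (hπ r))⟩
  have hsub : (Set.range fun g : IsoQ S => g • x₀) ⊆ Set.range π := by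
    rintro _ ⟨g, rfl⟩
    exact ⟨g • lexC S, hπeq _ _ (subset_closure ⟨g, rfl⟩)⟩
  exact closure_minimal hsub (isCompact_range hcont).isClosed (hmin x₀ x)

end UrysohnUltrametric

/-- `cLO(Q_S)`, with the natural action of `iso(Q_S)`, is the universal minimal flow
of `iso(Q_S)` : the space is compact, the action is continuous and minimal, and every
compact Hausdorff minimal flow of `iso(Q_S)` is a continuous equivariant image of it. -/
theorem cLOQ_is_universal_minimal_flow
    (S : Set ℝ) (hScount : S.Countable) (hSpos : ∀ s ∈ S, 0 < s) :
    CompactSpace (cLOQ S) ∧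
    Continuous (fun p : IsoQ S × cLOQ S => actQ S p.1 p.2) ∧
    (∀ r : cLOQ S, Dense (Set.range fun g : IsoQ S => actQ S g r)) ∧
    (∀ (X : Type) [TopologicalSpace X] [CompactSpace X] [T2Space X] [Nonempty X]
      (a : IsoQ S → X → X),
      (∀ x, a 1 x = x) →
      (∀ g h x, a (g * h) x = a g (a h x)) →
      (Continuous fun p : IsoQ S × X => a p.1 p.2) →
      (∀ x : X, Dense (Set.range fun g : IsoQ S => a g x)) →
      ∃ π : cLOQ S → X, Continuous π ∧ Function.Surjective π ∧
        ∀ (g : IsoQ S) (r : cLOQ S), π (actQ S g r) = a g (π r)) := by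
  refine ⟨inferInstance, continuous_smul, dense_orbit_cLOQ, ?_⟩
  intro X _ _ _ _ a h1 hmul hcont hmin
  let _ : MulAction (IsoQ S) X := { smul := a, one_smul := h1, mul_smul := hmul }
  have : ContinuousSMul (IsoQ S) X := ⟨hcont⟩
  exact exists_equivariant_surjection X hmin
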